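/- arXiv:1010.3234 — 2 statements merged into one kernel-verified Lean document; each statement's English description precedes it below -/
import Mathlib

section
/- The subgroups of the Whitten group Γ₂ fall into exactly 27 conjugacy classes, where two subgroups H, K of a group G are called conjugate if there exists g ∈ G with K = gHg⁻¹. -/
/-- An element `(ε₀, ε₁, …, ε_μ, p)` of the Whitten group `Γ_μ`:
a sign `ε₀ ∈ {±1}`, signs `ε₁, …, ε_μ` (indexed here by `Fin μ`, so `eps i` is `ε_{i+1}`),
and a permutation `p ∈ S_μ`. -/
@[ext]
structure Whitten (mu : ℕ) where
  e0 : ℤˣ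
  eps : Fin mu → ℤˣ
  perm : Equiv.Perm (Fin mu)

namespace Whitten

variable {mu : ℕ}

/-- The Whitten multiplication
`(ε₀,ε₁,…,ε_μ,p) * (ε₀',ε₁',…,ε_μ',q) = (ε₀ε₀', ε₁ε'_{p(1)}, …, ε_με'_{p(μ)}, qp)`. -/
instance : Mul (Whitten mu) :=
  ⟨fun a b => ⟨a.e0 * b.e0, fun i => a.eps i * b.eps (a.perm i), b.perm * a.perm⟩⟩

instance : One (Whitten mu) := ⟨⟨1, fun _ => 1, 1⟩⟩

instance : Inv (Whitten mu) :=
  ⟨fun a => ⟨a.e0⁻¹, fun i => (a.eps (a.perm⁻¹ i))⁻¹, a.perm⁻¹⟩⟩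

@[simp] lemma mul_e0 (a b : Whitten mu) : (a * b).e0 = a.e0 * b.e0 := rfl
@[simp] lemma mul_eps (a b : Whitten mu) (i : Fin mu) :
    (a * b).eps i = a.eps i * b.eps (a.perm i) := rfl
@[simp] lemma mul_perm (a b : Whitten mu) : (a * b).perm = b.perm * a.perm := rfl
@[simp] lemma one_e0 : (1 : Whitten mu).e0 = 1 := rfl
@[simp] lemma one_eps (i : Fin mu) : (1 : Whitten mu).eps i = 1 := rfl
@[simp] lemma one_perm : (1 : Whitten mu).perm = 1 := rfl
@[simp] lemma inv_e0 (a : Whitten mu) : (a⁻¹).e0 = a.e0⁻¹ := rfl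
@[simp] lemma inv_eps (a : Whitten mu) (i : Fin mu) :
    (a⁻¹).eps i = (a.eps (a.perm⁻¹ i))⁻¹ := rfl
@[simp] lemma inv_perm (a : Whitten mu) : (a⁻¹).perm = a.perm⁻¹ := rfl

/-- The Whitten group `Γ_μ`. -/
instance : Group (Whitten mu) where
  mul_assoc a b c := by
    ext i <;> simp [mul_assoc, Equiv.Perm.mul_apply]
  one_mul a := by ext i <;> simp
  mul_one a := by ext i <;> simp
  inv_mul_cancel a := by ext i <;> simp

end Whitten

/-- Two subgroups `H, K` of a group `G` are conjugate if there is `g ∈ G`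
with `K = g H g⁻¹`. -/
def SubgroupConj {G : Type*} [Group G] (H K : Subgroup G) : Prop :=
  ∃ g : G, K = Subgroup.map (MulAut.conj g).toMonoidHom H

namespace Whitten

/-- The number below `16` whose binary digits, from the most significant one, record which of
`ε₀`, `ε₁`, `ε₂` are `-1` and whether the permutation is the transposition. -/
def code (w : Whitten 2) : ℕ :=
  (if w.e0 = 1 then 0 else 8) + (if w.eps 0 = 1 then 0 else 4) +
    (if w.eps 1 = 1 then 0 else 2) + (if w.perm 0 = 0 then 0 else 1)

/-- The element of `Γ₂` with a given code. -/
def decode (n : ℕ) : Whitten 2 where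
  e0 := if n.testBit 3 then -1 else 1
  eps := ![if n.testBit 2 then -1 else 1, if n.testBit 1 then -1 else 1]
  perm := if n.testBit 0 then Equiv.swap 0 1 else 1

/-- Exchange the binary digits recording `ε₁` and `ε₂`. -/
def codeSwap (b : ℕ) : ℕ := (b &&& 9) ||| ((b &&& 4) >>> 1) ||| ((b &&& 2) <<< 1)

/-- The multiplication of `Γ₂` on codes. -/
def codeMul (a b : ℕ) : ℕ := a ^^^ bif a.testBit 0 then codeSwap b else b

/-- The inversion of `Γ₂` on codes. -/
def codeInv (a : ℕ) : ℕ := bif a.testBit 0 then codeSwap a else a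

lemma code_lt (w : Whitten 2) : code w < 16 := by
  unfold code; split_ifs <;> norm_num

instance : DecidableEq (Whitten 2) := fun a b =>
  decidable_of_iff (a.e0 = b.e0 ∧ a.eps = b.eps ∧ a.perm = b.perm) Whitten.ext_iff.symm

lemma decode_code (w : Whitten 2) : decode (code w) = w := by
  obtain ⟨e, f, p⟩ := w
  obtain ⟨a, b, rfl⟩ : ∃ a b, f = ![a, b] := ⟨f 0, f 1, by ext i; fin_cases i <;> rfl⟩
  revert e a b p
  decide +kernel

lemma code_decode : ∀ n < 16, code (decode n) = n := by decide +kernel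

lemma code_decode_mul : ∀ a < 16, ∀ b < 16, code (decode a * decode b) = codeMul a b := by
  decide +kernel

lemma code_decode_inv : ∀ a < 16, code (decode a)⁻¹ = codeInv a := by decide +kernel

lemma code_mul (a b : Whitten 2) : code (a * b) = codeMul (code a) (code b) := by
  simpa only [decode_code] using code_decode_mul _ (code_lt a) _ (code_lt b)

lemma code_inv (a : Whitten 2) : code a⁻¹ = codeInv (code a) := by
  simpa only [decode_code] using code_decode_inv _ (code_lt a)

lemma code_one : code 1 = 0 := by decide +kernel

/-- Binary masks of the sets of codes of representatives of the conjugacy classes of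
subgroups of `Γ₂`. -/
def repMasks : List ℕ :=
  [1, 3, 5, 65, 257, 513, 1025, 16385, 85, 105, 195, 771, 1285, 5185, 10305, 16705, 17025, 17425,
    33345, 255, 15555, 21845, 26985, 38505, 43605, 50115, 65535]

lemma card_repMasks : Nat.card {m // m ∈ repMasks} = 27 := by
  rw [Nat.card_eq_fintype_card,
    Fintype.card_of_subtype repMasks.toFinset fun _ => List.mem_toFinset]
  decide +kernel

lemma repMasks_one : ∀ r ∈ repMasks, r.testBit 0 := by decide +kernel

lemma repMasks_mul : ∀ r ∈ repMasks, ∀ a < 16, r.testBit a → ∀ b < 16, r.testBit b →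
    r.testBit (codeMul a b) := by
  decide +kernel

lemma repMasks_inv : ∀ r ∈ repMasks, ∀ a < 16, r.testBit a → r.testBit (codeInv a) := by
  decide +kernel

/-- Whether conjugation by the element with code `h` maps the elements whose codes satisfy `p`
exactly to those whose codes are in the mask `s`. Being Boolean, it is quick to evaluate. -/
def isConj (h : ℕ) (p : ℕ → Bool) (s : ℕ) : Bool :=
  (List.range 16).all fun x => p x == s.testBit (codeMul (codeMul h x) (codeInv h))

lemma isConj_iff {h : ℕ} {p : ℕ → Bool} {s : ℕ} : isConj h p s ↔
    ∀ x < 16, p x = s.testBit (codeMul (codeMul h x) (codeInv h)) := by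
  simp [isConj]

lemma repMasks_eq_of_isConj : ∀ r ∈ repMasks, ∀ s ∈ repMasks, ∀ h < 16,
    isConj h r.testBit s → r = s := by
  decide +kernel

/-- If `a` normalizes a representative and squares into it, then the representative together with
its coset by `a` is conjugate to a representative. The codes `0`, `1` and `4` suffice as
conjugators. -/
lemma exists_isConj_extension : ∀ r ∈ repMasks, ∀ a < 16, ¬ r.testBit a →
    r.testBit (codeMul a a) → isConj a r.testBit r →
    ∃ s ∈ repMasks, ∃ h ∈ [0, 1, 4],
      isConj h (fun x => r.testBit x || r.testBit (codeMul a x)) s := by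
  decide +kernel

/-- Representatives of the conjugacy classes of subgroups of `Γ₂`. -/
def rep (r : {m // m ∈ repMasks}) : Subgroup (Whitten 2) where
  carrier := {g | r.1.testBit (code g)}
  one_mem' := by
    rw [Set.mem_ofPred_eq, code_one]
    exact repMasks_one r r.2
  mul_mem' {a b} ha hb := by
    rw [Set.mem_ofPred_eq, code_mul]
    exact repMasks_mul r r.2 _ (code_lt a) ha _ (code_lt b) hb
  inv_mem' {a} ha := by
    rw [Set.mem_ofPred_eq, code_inv]
    exact repMasks_inv r r.2 _ (code_lt a) ha

lemma mem_rep {r : {m // m ∈ repMasks}} {g : Whitten 2} :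
    g ∈ rep r ↔ r.1.testBit (code g) := Iff.rfl

/-- `Γ₂` has sixteen elements, numbered by their codes. -/
def codeEquiv : Whitten 2 ≃ Fin 16 where
  toFun w := ⟨code w, code_lt w⟩
  invFun n := decode n
  left_inv := decode_code
  right_inv n := Fin.ext (code_decode n n.2)

instance : Finite (Whitten 2) := .of_equiv _ codeEquiv.symm

lemma card_whitten_two : Nat.card (Whitten 2) = 2 ^ 4 :=
  Nat.card_eq_of_equiv_fin codeEquiv

end Whitten

section SubgroupConj

variable {G : Type*} [Group G]

lemma subgroupConj_iff {H K : Subgroup G} :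
    SubgroupConj H K ↔ ∃ g : G, ∀ x, x ∈ H ↔ g * x * g⁻¹ ∈ K := by
  refine exists_congr fun g => ⟨?_, fun h => ?_⟩
  · rintro rfl x
    exact (Subgroup.mem_map_iff_mem (MulAut.conj g).injective).symm
  · ext y
    have := h (g⁻¹ * y * g)
    rw [show g * (g⁻¹ * y * g) * g⁻¹ = y by group] at this
    rw [← this, Subgroup.mem_map_equiv, MulAut.conj_symm_apply]

lemma subgroupConj_equivalence : Equivalence (@SubgroupConj G _) where
  refl H := subgroupConj_iff.2 ⟨1, by simp⟩
  symm {H K} h := by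
    obtain ⟨g, hg⟩ := subgroupConj_iff.1 h
    exact subgroupConj_iff.2 ⟨g⁻¹, fun x => by rw [hg]; simp [mul_assoc]⟩
  trans {H K L} h h' := by
    obtain ⟨g, hg⟩ := subgroupConj_iff.1 h
    obtain ⟨k, hk⟩ := subgroupConj_iff.1 h'
    exact subgroupConj_iff.2 ⟨k * g, fun x => by rw [hg, hk]; simp [mul_assoc]⟩

end SubgroupConj

namespace Whitten

lemma rep_conj_injective {r s : {m // m ∈ repMasks}}
    (h : SubgroupConj (rep r) (rep s)) : r = s := by
  obtain ⟨g, hg⟩ := subgroupConj_iff.1 h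
  refine Subtype.ext (repMasks_eq_of_isConj r r.2 s s.2 _ (code_lt g)
    (isConj_iff.2 fun x hx => ?_))
  have := hg (decode x)
  rwa [mem_rep, mem_rep, code_mul, code_mul, code_inv, code_decode x hx,
    ← Bool.eq_iff_iff] at this

/-- A subgroup containing a representative with index two is conjugate to a representative. -/
lemma exists_rep_conj_of_index_two {r : {m // m ∈ repMasks}} {L : Subgroup (Whitten 2)}
    (hL : rep r ≤ L)
    (hmul : ∀ x ∈ L, ∀ y ∈ L, (x * y ∈ rep r ↔ (x ∈ rep r ↔ y ∈ rep r)))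
    {a : Whitten 2} (ha : a ∈ L) (har : a ∉ rep r) : ∃ s, SubgroupConj L (rep s) := by
  have hconj : ∀ x, x ∈ rep r ↔ a * x * a⁻¹ ∈ rep r := fun x => by
    by_cases hx : x ∈ L
    · rw [hmul _ (mul_mem ha hx) _ (inv_mem ha), hmul a ha x hx, inv_mem_iff]
      tauto
    · refine iff_of_false (fun h => hx (hL h)) fun h => hx ?_
      exact (Subgroup.mul_mem_cancel_left _ ha).1
        ((Subgroup.mul_mem_cancel_right _ (inv_mem ha)).1 (hL h))
  obtain ⟨s, hs, h, hh, H⟩ := exists_isConj_extension r r.2 (code a) (code_lt a) har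
    (by rw [← code_mul]; exact (hmul a ha a ha).2 Iff.rfl)
    (isConj_iff.2 fun x hx => by
      rw [Bool.eq_iff_iff, ← code_decode x hx, ← code_inv, ← code_mul, ← code_mul]
      exact hconj _)
  have hh' : h < 16 := (by decide : ∀ h ∈ [0, 1, 4], h < 16) h hh
  refine ⟨⟨s, hs⟩, subgroupConj_iff.2 ⟨decode h, fun x => ?_⟩⟩
  rw [mem_rep, code_mul, code_mul, code_inv, code_decode h hh',
    ← isConj_iff.1 H (code x) (code_lt x), ← code_mul, Bool.or_eq_true, ← mem_rep, ← mem_rep]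
  refine ⟨fun hxL => ?_, ?_⟩
  · rw [hmul a ha x hxL]
    tauto
  · rintro (hx | hx)
    · exact hL hx
    · exact (Subgroup.mul_mem_cancel_left _ ha).1 (hL hx)

lemma exists_rep_conj_of_card (n : ℕ) : ∀ H : Subgroup (Whitten 2), Nat.card H = 2 ^ n →
    ∃ r, SubgroupConj H (rep r) := by
  induction n with
  | zero =>
    intro H hH
    obtain rfl := Subgroup.card_eq_one.1 hH
    refine ⟨⟨1, by decide⟩, subgroupConj_iff.2 ⟨1, fun x => ?_⟩⟩
    rw [one_mul, inv_one, mul_one, Subgroup.mem_bot, mem_rep, ← decode_code x,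
      code_decode _ (code_lt x)]
    have hlt := code_lt x
    generalize code x = m at hlt
    revert m
    decide +kernel
  | succ n ih =>
    intro H hH
    obtain ⟨K, hK⟩ := Sylow.exists_subgroup_card_pow_prime (G := H) 2 (n := n)
      (hH ▸ pow_dvd_pow 2 n.le_succ)
    have hindex : K.index = 2 := by
      have := K.card_mul_index
      rw [hK, hH, pow_succ] at this
      exact Nat.eq_of_mul_eq_mul_left (by positivity) this
    obtain ⟨r, hr⟩ := ih (K.map H.subtype) (by
      rw [Subgroup.card_map_of_injective H.subtype_injective, hK])
    obtain ⟨g, hg⟩ := subgroupConj_iff.1 (subgroupConj_equivalence.symm hr)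
    let L : Subgroup (Whitten 2) := H.comap (MulAut.conj g).toMonoidHom
    have hLH : SubgroupConj L H := subgroupConj_iff.2 ⟨g, fun x => Iff.rfl⟩
    have hrep : ∀ x (hx : x ∈ L), x ∈ rep r ↔ (⟨g * x * g⁻¹, hx⟩ : H) ∈ K := fun x hx => by
      rw [hg, ← Subgroup.mem_map_iff_mem H.subtype_injective]
      rfl
    obtain ⟨a, ha⟩ : ∃ a, a ∉ K := by
      by_contra! h
      rw [(Subgroup.eq_top_iff' K).2 h, Subgroup.index_top] at hindex
      norm_num at hindex
    have haL : g⁻¹ * a * g ∈ L := by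
      change g * (g⁻¹ * a * g) * g⁻¹ ∈ H
      rw [show g * (g⁻¹ * a * g) * g⁻¹ = (a : Whitten 2) by group]
      exact a.2
    obtain ⟨s, hs⟩ := exists_rep_conj_of_index_two (r := r) (L := L)
      (fun x hx => Subgroup.map_subtype_le K ((hg x).1 hx))
      (fun x hx y hy => by
        rw [hrep x hx, hrep y hy, hrep _ (mul_mem hx hy), ← Subgroup.mul_mem_iff_of_index_two hindex]
        simp [mul_assoc])
      haL (by
        rw [hrep _ haL]
        convert ha using 2
        exact Subtype.ext (by group))
    exact ⟨s, subgroupConj_equivalence.trans (subgroupConj_equivalence.symm hLH) hs⟩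

lemma exists_rep_conj (H : Subgroup (Whitten 2)) : ∃ r, SubgroupConj H (rep r) := by
  obtain ⟨n, -, hn⟩ := (Nat.dvd_prime_pow Nat.prime_two).1
    (card_whitten_two ▸ H.card_subgroup_dvd_card)
  exact exists_rep_conj_of_card n H hn

end Whitten

/-- The subgroups of the Whitten group `Γ₂` fall into exactly `27` conjugacy classes. -/
theorem whitten_two_card_conjugacy_classes_of_subgroups :
    Nat.card (Quot (@SubgroupConj (Whitten 2) _)) = 27 := by
  refine (Nat.card_eq_of_bijective (fun r => Quot.mk _ (Whitten.rep r))
    ⟨fun r s h => ?_, ?_⟩).symm.trans Whitten.card_repMasks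
  · exact Whitten.rep_conj_injective
      (subgroupConj_equivalence.eqvGen_iff.1 (Quot.eqvGen_exact h))
  · rintro ⟨H⟩
    obtain ⟨r, hr⟩ := Whitten.exists_rep_conj H
    exact ⟨r, (Quot.sound hr).symm⟩
end

section
/- The Whitten group Γ₃ has exactly 420 subgroups, and these subgroups fall into exactly 131 conjugacy classes, where two subgroups H, K of a group G are called conjugate if there exists g ∈ G with K = gHg⁻¹. -/
namespace WhittenThree

/-! ### The group `Γ₃` on the integers below `96`

The integer `16 * p + v`, with `p < 6` and `v < 16`, stands for the element whose permutation is
the `p`-th one in a fixed list and whose signs `ε₀, …, ε₃` are read off the binary digits of `v`. -/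

/-- The sign `-1` for `true` and `1` for `false`. -/
def sign (b : Bool) : ℤˣ := bif b then -1 else 1

/-- A list of the six permutations of `Fin 3`, the even ones first. -/
def perms : ℕ → Equiv.Perm (Fin 3)
  | 0 => 1
  | 1 => finRotate 3
  | 2 => finRotate 3 * finRotate 3
  | 3 => Equiv.swap 0 1
  | 4 => Equiv.swap 1 2
  | _ => Equiv.swap 0 2

/-- The element of `Γ₃` with a given number. -/
def dec (i : ℕ) : Whitten 3 :=
  ⟨sign (i.testBit 0), fun k => sign (i.testBit (k + 1)), perms (i / 16)⟩

/-- The number of the permutation `perms q * perms p`, from the table of all products,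
which are the digits in base `16` of one number. -/
def permMul (p q : ℕ) : ℕ := (99114052089257767264061560770932407284240 >>> (4 * (6 * p + q))) % 16

/-- The number of `(perms p)⁻¹`. -/
def permInv (p : ℕ) : ℕ := (5517600 >>> (4 * p)) % 16

/-- The action of `perms p` on sign vectors, from the table of all its values,
which are the digits in base `16` of one number. -/
def signAct (p v : ℕ) : ℕ :=
  (39165560092841441732768008986356990911606202039504858157639188165834974571293459304853283735592919413637282702570000
    >>> (4 * (16 * p + v))) % 16

/-- The Whitten multiplication on numbers. -/
def mul (i j : ℕ) : ℕ :=
  16 * permMul (i / 16) (j / 16) + (i % 16 ^^^ signAct (i / 16) (j % 16))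

/-- Inversion in the Whitten group on numbers. -/
def inv (i : ℕ) : ℕ :=
  16 * permInv (i / 16) + signAct (permInv (i / 16)) (i % 16)

/-- Powers in the Whitten group on numbers. -/
def pow (i : ℕ) : ℕ → ℕ
  | 0 => 0
  | k + 1 => mul i (pow i k)

lemma sign_xor (a b : Bool) : sign (a ^^ b) = sign a * sign b := by
  cases a <;> cases b <;> rfl

lemma sign_injective : Function.Injective sign := by decide

lemma sign_surjective : Function.Surjective sign := by decide

lemma perms_permMul : ∀ p < 6, ∀ q < 6,
    permMul p q < 6 ∧ perms (permMul p q) = perms q * perms p := by decide +kernel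

lemma perms_injective : ∀ p < 6, ∀ q < 6, perms p = perms q → p = q := by decide +kernel

lemma perms_surjective : ∀ s, ∃ p < 6, perms p = s := by decide +kernel

lemma testBit_signAct : ∀ p < 6, ∀ v < 16, (signAct p v).testBit 0 = v.testBit 0 ∧
    ∀ k : Fin 3, (signAct p v).testBit (k + 1) = v.testBit (perms p k + 1) := by decide +kernel

lemma signAct_lt (p v : ℕ) : signAct p v < 16 := Nat.mod_lt _ (by norm_num)

lemma testBit_mod_sixteen (i : ℕ) {k : ℕ} (hk : k < 4) : (i % 16).testBit k = i.testBit k := by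
  have := Nat.testBit_mod_two_pow i 4 k
  simpa [hk] using this

lemma testBit_sixteen_mul_add (a : ℕ) {v k : ℕ} (hv : v < 16) (hk : k < 4) :
    (16 * a + v).testBit k = v.testBit k := by
  rw [← testBit_mod_sixteen _ hk, Nat.mul_add_mod, Nat.mod_eq_of_lt hv]

lemma xor_lt_sixteen {v w : ℕ} (hv : v < 16) (hw : w < 16) : v ^^^ w < 16 :=
  Nat.xor_lt_two_pow (n := 4) hv hw

lemma mul_lt {i j : ℕ} (hi : i < 96) (hj : j < 96) : mul i j < 96 := by
  have h := (perms_permMul (i / 16) (by omega) (j / 16) (by omega)).1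
  have h' := xor_lt_sixteen (Nat.mod_lt i (by norm_num)) (signAct_lt (i / 16) (j % 16))
  unfold mul
  omega

lemma dec_mul {i j : ℕ} (hi : i < 96) (hj : j < 96) : dec (mul i j) = dec i * dec j := by
  have hp := (perms_permMul (i / 16) (by omega) (j / 16) (by omega)).2
  have hv := xor_lt_sixteen (Nat.mod_lt i (by norm_num)) (signAct_lt (i / 16) (j % 16))
  have hs := testBit_signAct (i / 16) (by omega) (j % 16) (Nat.mod_lt j (by norm_num))
  ext : 1
  · change sign ((mul i j).testBit 0) = sign (i.testBit 0) * sign (j.testBit 0)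
    rw [mul, testBit_sixteen_mul_add _ hv (by norm_num), Nat.testBit_xor, hs.1,
      testBit_mod_sixteen _ (by norm_num), testBit_mod_sixteen _ (by norm_num), sign_xor]
  · funext k
    change sign ((mul i j).testBit (k + 1)) =
      sign (i.testBit (k + 1)) * sign (j.testBit (perms (i / 16) k + 1))
    rw [mul, testBit_sixteen_mul_add _ hv (by omega), Nat.testBit_xor, hs.2,
      testBit_mod_sixteen _ (by omega), testBit_mod_sixteen _ (by omega), sign_xor]
  · change perms (mul i j / 16) = perms (j / 16) * perms (i / 16)
    rw [← hp]
    congr 1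
    unfold mul
    omega

lemma dec_zero : dec 0 = 1 := by
  ext : 1
  · rfl
  · funext k
    simp [dec, sign]
  · rfl

lemma eq_of_testBit_eq : ∀ v < 16, ∀ w < 16,
    (∀ k < 4, v.testBit k = w.testBit k) → v = w := by decide +kernel

lemma dec_injOn {i j : ℕ} (hi : i < 96) (hj : j < 96) (h : dec i = dec j) : i = j := by
  have hp := perms_injective (i / 16) (by omega) (j / 16) (by omega) (congrArg Whitten.perm h)
  have hs := eq_of_testBit_eq (i % 16) (Nat.mod_lt _ (by norm_num)) (j % 16)
    (Nat.mod_lt _ (by norm_num)) fun k hk => by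
      rw [testBit_mod_sixteen _ hk, testBit_mod_sixteen _ hk]
      rcases k with _ | k
      · exact sign_injective (congrArg Whitten.e0 h)
      · exact sign_injective (congrFun (congrArg Whitten.eps h) ⟨k, by omega⟩)
  omega

lemma exists_testBit_eq : ∀ b₀ b₁ b₂ b₃ : Bool, ∃ v < 16, v.testBit 0 = b₀ ∧ v.testBit 1 = b₁ ∧
    v.testBit 2 = b₂ ∧ v.testBit 3 = b₃ := by decide +kernel

lemma exists_dec_eq (a : Whitten 3) : ∃ i < 96, dec i = a := by
  obtain ⟨p, hp, hpa⟩ := perms_surjective a.perm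
  obtain ⟨b₀, h₀⟩ := sign_surjective a.e0
  obtain ⟨b₁, h₁⟩ := sign_surjective (a.eps 0)
  obtain ⟨b₂, h₂⟩ := sign_surjective (a.eps 1)
  obtain ⟨b₃, h₃⟩ := sign_surjective (a.eps 2)
  obtain ⟨v, hv, hv₀, hv₁, hv₂, hv₃⟩ := exists_testBit_eq b₀ b₁ b₂ b₃
  refine ⟨16 * p + v, by omega, ?_⟩
  ext : 1
  · change sign ((16 * p + v).testBit 0) = _
    rw [testBit_sixteen_mul_add _ hv (by norm_num), hv₀, h₀]
  · funext k
    change sign ((16 * p + v).testBit (k + 1)) = _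
    rw [testBit_sixteen_mul_add _ hv (by omega)]
    fin_cases k
    · exact (congrArg sign hv₁).trans h₁
    · exact (congrArg sign hv₂).trans h₂
    · exact (congrArg sign hv₃).trans h₃
  · change perms ((16 * p + v) / 16) = _
    rw [← hpa]
    congr 1
    omega

lemma mul_inv_eq_zero : ∀ i < 96, inv i < 96 ∧ mul i (inv i) = 0 := by decide +kernel

lemma inv_lt {i : ℕ} (hi : i < 96) : inv i < 96 := (mul_inv_eq_zero i hi).1

lemma dec_inv {i : ℕ} (hi : i < 96) : dec (inv i) = (dec i)⁻¹ := by
  rw [eq_inv_iff_mul_eq_one, mul_eq_one_comm, ← dec_mul hi (inv_lt hi),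
    (mul_inv_eq_zero i hi).2, dec_zero]

lemma pow_lt {i : ℕ} (hi : i < 96) (k : ℕ) : pow i k < 96 := by
  induction k with
  | zero => norm_num [pow]
  | succ k ih => exact mul_lt hi ih

lemma dec_pow {i : ℕ} (hi : i < 96) (k : ℕ) : dec (pow i k) = dec i ^ k := by
  induction k with
  | zero => rw [pow, dec_zero, pow_zero]
  | succ k ih => rw [pow, dec_mul hi (pow_lt hi k), ih, pow_succ']

instance : Finite (Whitten 3) :=
  Finite.of_surjective (fun i : Fin 96 => dec i) fun a =>
    let ⟨i, hi, h⟩ := exists_dec_eq a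
    ⟨⟨i, hi⟩, h⟩
/-! ### Evaluation in the kernel

The functions of this section are instances of the recursor for lists, which the kernel unfolds
faster than structural recursion, and `force` makes it evaluate a number before its use. -/

/-- `List.foldr`, as an instance of the recursor. -/
noncomputable def fold {α β : Type} (f : α → β → β) (b : β) (l : List α) : β :=
  List.rec b (fun a _ r => f a r) l

/-- `List.map`, as an instance of the recursor. -/
noncomputable def map {α β : Type} (f : α → β) (l : List α) : List β :=
  fold (fun a r => f a :: r) [] l

/-- `List.all`, as an instance of the recursor. -/
noncomputable def all {α : Type} (f : α → Bool) (l : List α) : Bool :=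
  fold (fun a r => f a && r) true l

/-- Membership in a list of numbers. -/
noncomputable def mem (a : ℕ) (l : List ℕ) : Bool :=
  fold (fun b r => Nat.beq a b || r) false l

/-- Remove the repetitions from a list of numbers. -/
noncomputable def nub : List ℕ → List ℕ
  | [] => []
  | a :: l => bif mem a l then nub l else a :: nub l

/-- Apply a function to a number, evaluating the number first. -/
noncomputable def force {α : Type} (x : ℕ) (k : ℕ → α) : α :=
  Nat.rec (k 0) (fun n _ => k (Nat.succ n)) x

/-- Apply a function to a list of numbers, evaluating its entries first. -/
noncomputable def forceList {α : Type} : List ℕ → (List ℕ → α) → α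
  | [], k => k []
  | a :: l, k => force a fun a => forceList l fun l => k (a :: l)

/-- Apply a function to a list of lists of numbers, evaluating their entries first. -/
noncomputable def forceLists {α : Type} : List (List ℕ) → (List (List ℕ) → α) → α
  | [], k => k []
  | a :: l, k => forceList a fun a => forceLists l fun l => k (a :: l)

lemma fold_eq_foldr {α β : Type} (f : α → β → β) (b : β) (l : List α) :
    fold f b l = l.foldr f b := by
  induction l with
  | nil => rfl
  | cons a l ih => rw [List.foldr_cons, ← ih]; rfl

lemma map_eq_map {α β : Type} (f : α → β) (l : List α) : map f l = l.map f := by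
  rw [map, fold_eq_foldr, List.map_eq_foldr]

lemma all_eq_true_iff {α : Type} (f : α → Bool) (l : List α) :
    all f l = true ↔ ∀ x ∈ l, f x = true := by
  rw [all, fold_eq_foldr]
  induction l with
  | nil => simp
  | cons a l ih => cases h : f a <;> simp [h, ih]

lemma mem_eq_true_iff (a : ℕ) (l : List ℕ) : mem a l = true ↔ a ∈ l := by
  rw [mem, fold_eq_foldr]
  induction l with
  | nil => simp
  | cons b l ih =>
    by_cases h : a = b
    · subst h; simp
    · have : Nat.beq a b = false := by
        rw [← Bool.not_eq_true, Nat.beq_eq]; exact h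
      simp [h, ih, this]

lemma nub_spec (l : List ℕ) : (nub l).Nodup ∧ ∀ x, x ∈ nub l ↔ x ∈ l := by
  induction l with
  | nil => simp [nub]
  | cons a l ih =>
    by_cases h : a ∈ l
    · have h' := (mem_eq_true_iff a l).2 h
      simp only [nub, h', cond_true]
      refine ⟨ih.1, fun x => ?_⟩
      rw [ih.2, List.mem_cons]
      exact ⟨Or.inr, fun hx => hx.elim (fun e => e ▸ h) id⟩
    · have h' : mem a l = false := by
        rwa [← Bool.not_eq_true, mem_eq_true_iff]
      simp only [nub, h', cond_false]
      exact ⟨List.nodup_cons.2 ⟨mt (ih.2 a).1 h, ih.1⟩, fun x => by simp [ih.2]⟩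

lemma card_setOf_mem (l : List ℕ) : Nat.card {x | x ∈ l} = (nub l).length := by
  have h : {x | x ∈ l} = ((nub l).toFinset : Set ℕ) := by
    ext x
    simp [(nub_spec l).2]
  rw [h, Nat.card_coe_set_eq, Set.ncard_coe_finset, List.toFinset_card_of_nodup (nub_spec l).1]

lemma force_eq {α : Type} (x : ℕ) (k : ℕ → α) : force x k = k x := by
  cases x <;> rfl

lemma forceList_eq {α : Type} (l : List ℕ) (k : List ℕ → α) : forceList l k = k l := by
  induction l generalizing k with
  | nil => rfl
  | cons a l ih => rw [forceList, force_eq, ih]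

lemma forceLists_eq {α : Type} (S : List (List ℕ)) (k : List (List ℕ) → α) :
    forceLists S k = k S := by
  induction S generalizing k with
  | nil => rfl
  | cons a l ih => rw [forceLists, forceList_eq, ih]

/-! ### Sets of numbers as binary masks -/

/-- The number with binary digit `1` at the members of `l`. -/
noncomputable def mask (l : List ℕ) : ℕ := fold (fun x m => Nat.lor (Nat.pow 2 x) m) 0 l

/-- The number whose digits in base `256` are the entries of `l`. -/
noncomputable def digits (l : List ℕ) : ℕ := fold (fun a m => a + 256 * m) 0 l

/-- The digit of `t` in base `256` at the place `x`. -/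
def lookup (t x : ℕ) : ℕ := (t >>> (8 * x)) % 256

lemma testBit_mask (l : List ℕ) (x : ℕ) : (mask l).testBit x = true ↔ x ∈ l := by
  rw [mask, fold_eq_foldr]
  induction l with
  | nil => simp
  | cons a l ih =>
    rw [List.foldr_cons, List.mem_cons, ← ih]
    change (2 ^ a ||| _).testBit x = true ↔ _
    rw [Nat.testBit_or, Nat.testBit_two_pow, Bool.or_eq_true, decide_eq_true_iff,
      eq_comm]

lemma mask_eq_iff {l l' : List ℕ} : mask l = mask l' ↔ ∀ x, x ∈ l ↔ x ∈ l' := by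
  refine ⟨fun h x => by rw [← testBit_mask, h, testBit_mask], fun h => ?_⟩
  refine Nat.eq_of_testBit_eq fun x => Bool.eq_iff_iff.2 ?_
  rw [testBit_mask, testBit_mask, h]

lemma lookup_digits (l : List ℕ) (hl : ∀ a ∈ l, a < 256) (x : ℕ) (hx : x < l.length) :
    lookup (digits l) x = l[x] := by
  have digits_cons (a : ℕ) (l : List ℕ) : digits (a :: l) = a + 256 * digits l := rfl
  induction l generalizing x with
  | nil => simp at hx
  | cons a l ih =>
    have ha := hl a (by simp)
    rcases x with _ | x
    · rw [List.getElem_cons_zero, digits_cons, lookup, mul_zero, Nat.shiftRight_zero,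
        Nat.add_mul_mod_self_left, Nat.mod_eq_of_lt ha]
    · rw [List.getElem_cons_succ, ← ih (fun b hb => hl b (by simp [hb])) x (by simpa using hx),
        digits_cons, lookup, lookup, show 8 * (x + 1) = 8 + 8 * x by ring, Nat.shiftRight_add]
      congr 2
      rw [Nat.shiftRight_eq_div_pow]
      omega

/-! ### Listing the subgroups

The numbers below each of `1`, `2`, `4`, `8`, `16`, `48` and `96` form a subgroup of prime index
in the next one. A subgroup of the larger one is either contained in the smaller one, or generated
by its intersection with the smaller one and any one of its other elements. -/

/-- The union of the translates of `l` by the first `p` powers of `g`. -/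
noncomputable def extend (l : List ℕ) (g : ℕ) : ℕ → List ℕ
  | 0 => []
  | p + 1 => l ++ map (mul g) (extend l g p)

/-- The test whether the subgroup `l` is normalized by `g` and contains `g ^ p`, and whether `g`
is the least number in its coset. -/
noncomputable def admissible (p : ℕ) (l : List ℕ) (g : ℕ) : Bool :=
  mem (pow g p) l && all (fun x => g.ble (mul g x) && mem (mul (inv g) (mul x g)) l) l

/-- From the subgroups consisting of numbers below `n`, list those of numbers below `p * n`. -/
noncomputable def step (n p : ℕ) (S : List (List ℕ)) : List (List ℕ) :=
  S ++ S.flatMap fun l => ((List.range' n n).filter (admissible p l)).map fun g => extend l g p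

/-- The list of all subgroups. -/
noncomputable def subgroups : List (List ℕ) :=
  step 48 2 <| step 16 3 <| step 8 2 <| step 4 2 <| step 2 2 <| step 1 2 [[0]]

/-- The list `l` consists of the numbers of the elements of `A`. -/
def Codes (l : List ℕ) (A : Set (Whitten 3)) : Prop := ∀ x, x ∈ l ↔ x < 96 ∧ dec x ∈ A

lemma mem_extend {l : List ℕ} {A : Set (Whitten 3)} (hl : Codes l A) {g : ℕ} (hg : g < 96)
    (p : ℕ) : Codes (extend l g p) {a | ∃ k < p, ∃ h ∈ A, a = dec g ^ k * h} := by
  induction p with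
  | zero => intro x; simp [extend]
  | succ p ih =>
    intro x
    rw [extend, map_eq_map, List.mem_append, hl x, List.mem_map]
    constructor
    · rintro (⟨hx, hxA⟩ | ⟨y, hy, rfl⟩)
      · exact ⟨hx, 0, by omega, _, hxA, by simp⟩
      · obtain ⟨hy, k, hk, h, hh, e⟩ := (ih y).1 hy
        refine ⟨mul_lt hg hy, k + 1, by omega, h, hh, ?_⟩
        rw [dec_mul hg hy, e, pow_succ', mul_assoc]
    · rintro ⟨hx, k, hk, h, hh, e⟩
      rcases k with _ | k
      · left
        rw [pow_zero, one_mul] at e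
        exact ⟨hx, e ▸ hh⟩
      · right
        have hy := mul_lt (inv_lt hg) hx
        have ey : dec (mul (inv g) x) = (dec g)⁻¹ * dec x := by
          rw [dec_mul (inv_lt hg) hx, dec_inv hg]
        refine ⟨mul (inv g) x, (ih _).2 ⟨hy, k, by omega, h, hh, ?_⟩, ?_⟩
        · rw [ey, e, pow_succ', mul_assoc, inv_mul_cancel_left]
        · refine dec_injOn (mul_lt hg hy) hx ?_
          rw [dec_mul hg hy, ey, mul_inv_cancel_left]

lemma exists_subgroup_of_mul_mem {G : Type*} [Group G] [Finite G] (A : Set G) (one : 1 ∈ A)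
    (mul : ∀ a ∈ A, ∀ b ∈ A, a * b ∈ A) : ∃ K : Subgroup G, (K : Set G) = A := by
  let M : Submonoid G := ⟨⟨A, fun {a b} ha hb => mul a ha b hb⟩, one⟩
  refine ⟨{ M with inv_mem' := fun {a} ha => ?_ }, rfl⟩
  have : a⁻¹ = a ^ (Nat.card G - 1) := by
    rw [inv_eq_iff_mul_eq_one, ← pow_succ', Nat.sub_add_cancel Nat.card_pos, pow_card_eq_one']
  rw [this]
  exact M.pow_mem ha _

lemma exists_subgroup_extension {G : Type*} [Group G] [Finite G] (H : Subgroup G) (g : G) (p : ℕ)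
    (hp : 0 < p) (hgp : g ^ p ∈ H) (hn : ∀ h ∈ H, g⁻¹ * h * g ∈ H) :
    ∃ K : Subgroup G, (K : Set G) = {a | ∃ k < p, ∃ h ∈ H, a = g ^ k * h} := by
  refine exists_subgroup_of_mul_mem _ ⟨0, hp, 1, H.one_mem, by simp⟩ ?_
  have mul_gen : ∀ a ∈ {a | ∃ k < p, ∃ h ∈ H, a = g ^ k * h},
      a * g ∈ {a | ∃ k < p, ∃ h ∈ H, a = g ^ k * h} := by
    rintro _ ⟨k, hk, h, hh, rfl⟩
    have e : g ^ k * h * g = g ^ (k + 1) * (g⁻¹ * h * g) := by rw [pow_succ]; group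
    by_cases hk' : k + 1 < p
    · exact ⟨k + 1, hk', _, hn h hh, e⟩
    · have : k + 1 = p := by omega
      exact ⟨0, hp, _, H.mul_mem hgp (hn h hh), by rw [e, this, pow_zero, one_mul]⟩
  rintro a ha _ ⟨k, -, h, hh, rfl⟩
  rw [← mul_assoc]
  have : a * g ^ k ∈ {a | ∃ k < p, ∃ h ∈ H, a = g ^ k * h} := by
    induction k with
    | zero => simpa using ha
    | succ k ih => rw [pow_succ, ← mul_assoc]; exact mul_gen _ ih
  obtain ⟨j, hj, h', hh', e⟩ := this
  exact ⟨j, hj, h' * h, H.mul_mem hh' hh, by rw [e, mul_assoc]⟩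

lemma admissible_iff (p : ℕ) (l : List ℕ) (g : ℕ) : admissible p l g = true ↔
    pow g p ∈ l ∧ ∀ x ∈ l, g ≤ mul g x ∧ mul (inv g) (mul x g) ∈ l := by
  simp [admissible, mem_eq_true_iff, all_eq_true_iff]

lemma mem_step {n p : ℕ} {S : List (List ℕ)} {l : List ℕ} : l ∈ step n p S ↔
    l ∈ S ∨ ∃ l' ∈ S, ∃ g, n ≤ g ∧ g < 2 * n ∧ admissible p l' g = true ∧ l = extend l' g p := by
  simp only [step, List.mem_append, List.mem_flatMap, List.mem_map, List.mem_filter,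
    List.mem_range'_1, two_mul, and_assoc, eq_comm]

lemma exists_codes_of_mem_step {n p : ℕ} (hn : 2 * n ≤ 96) (hp : 0 < p) {S : List (List ℕ)}
    (hS : ∀ l ∈ S, ∃ K : Subgroup (Whitten 3), Codes l K) :
    ∀ l ∈ step n p S, ∃ K : Subgroup (Whitten 3), Codes l K := by
  intro l hl
  rcases mem_step.1 hl with hl | ⟨l', hl', g, -, hg, ha, rfl⟩
  · exact hS l hl
  obtain ⟨H, hH⟩ := hS l' hl'
  rw [admissible_iff] at ha
  have hg' : g < 96 := by omega
  obtain ⟨K, hK⟩ := exists_subgroup_extension H (dec g) p hp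
    (by rw [← dec_pow hg']; exact ((hH _).1 ha.1).2)
    (fun h hh => by
      obtain ⟨x, hx, rfl⟩ := exists_dec_eq h
      have := ((hH _).1 (ha.2 x ((hH x).2 ⟨hx, hh⟩)).2).2
      rwa [dec_mul (inv_lt hg') (mul_lt hx hg'), dec_mul hx hg', dec_inv hg', ← mul_assoc] at this)
  refine ⟨K, ?_⟩
  rw [hK]
  exact mem_extend hH hg' p

/-- The properties of the numbers below `n` and below `p * n` on which `step n p` relies. -/
def IsChainStep (n p : ℕ) : Prop :=
  (∀ x < p * n, n ≤ x → x < 2 * n ∨ (n ≤ mul x x ∧ mul x x < 2 * n)) ∧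
  ∀ g < 2 * n, n ≤ g →
    pow g p < n ∧ (∀ x < n, n ≤ mul g x ∧ mul g x < 2 * n ∧ mul (inv g) (mul x g) < n) ∧
    ∀ x < p * n, mul g x < p * n ∧ ∃ k < p, mul (inv (pow g k)) x < n

instance (n p : ℕ) : Decidable (IsChainStep n p) := by unfold IsChainStep; infer_instance

/-- The elements of `K` whose numbers are below `n`. -/
def below (n : ℕ) (K : Subgroup (Whitten 3)) : Set (Whitten 3) := {a | a ∈ K ∧ ∃ y < n, dec y = a}

lemma dec_mem_below {n : ℕ} (hn : n ≤ 96) (K : Subgroup (Whitten 3)) {x : ℕ} (hx : x < 96) :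
    dec x ∈ below n K ↔ x < n ∧ dec x ∈ K := by
  refine ⟨fun ⟨h, y, hy, e⟩ => ⟨?_, h⟩, fun ⟨h, h'⟩ => ⟨h', x, h, rfl⟩⟩
  rwa [← dec_injOn (by omega) hx e]

lemma exists_mem_step {n p : ℕ} (hp : 2 ≤ p) (hn : p * n ≤ 96) (hc : IsChainStep n p)
    {S : List (List ℕ)} (K : Subgroup (Whitten 3)) (hS : ∃ l ∈ S, Codes l (below n K)) :
    ∃ l ∈ step n p S, Codes l (below (p * n) K) := by
  classical
  obtain ⟨l, hl, hK⟩ := hS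
  have h2 : 2 * n ≤ p * n := Nat.mul_le_mul_right n hp
  have hlK {x : ℕ} : x ∈ l ↔ x < n ∧ dec x ∈ K := by
    rw [hK]
    exact ⟨fun ⟨h, h'⟩ => (dec_mem_below (by omega) K h).1 h',
      fun h => ⟨by omega, (dec_mem_below (by omega) K (by omega)).2 h⟩⟩
  by_cases hx : ∃ x, n ≤ x ∧ x < p * n ∧ dec x ∈ K
  · have hg : ∃ x, n ≤ x ∧ x < 2 * n ∧ dec x ∈ K := by
      obtain ⟨x, hnx, hx, hxK⟩ := hx
      rcases hc.1 x hx hnx with h | h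
      · exact ⟨x, hnx, h, hxK⟩
      · refine ⟨mul x x, h.1, h.2, ?_⟩
        rw [dec_mul (by omega) (by omega)]
        exact K.mul_mem hxK hxK
    obtain ⟨g, ⟨hng, hg, hgK⟩, hmin⟩ :
        ∃ g, (n ≤ g ∧ g < 2 * n ∧ dec g ∈ K) ∧ ∀ x, n ≤ x ∧ x < 2 * n ∧ dec x ∈ K → g ≤ x :=
      ⟨Nat.find hg, Nat.find_spec hg, fun x hx => Nat.find_min' hg hx⟩
    obtain ⟨hgp, hcoset, hcover⟩ := hc.2 g hg hng
    have hg' : g < 96 := by omega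
    refine ⟨extend l g p, mem_step.2 (Or.inr ⟨l, hl, g, hng, hg, ?_, rfl⟩), ?_⟩
    · refine (admissible_iff p l g).2 ⟨hlK.2 ⟨hgp, ?_⟩, fun x hxl => ?_⟩
      · rw [dec_pow hg']
        exact K.pow_mem hgK p
      · obtain ⟨hx, hxK⟩ := hlK.1 hxl
        obtain ⟨h₁, h₂, h₃⟩ := hcoset x hx
        have hx' : x < 96 := by omega
        refine ⟨hmin _ ⟨h₁, h₂, ?_⟩, hlK.2 ⟨h₃, ?_⟩⟩
        · rw [dec_mul hg' hx']
          exact K.mul_mem hgK hxK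
        · rw [dec_mul (inv_lt hg') (mul_lt hx' hg'), dec_mul hx' hg', dec_inv hg']
          exact K.mul_mem (K.inv_mem hgK) (K.mul_mem hxK hgK)
    · intro x
      rw [mem_extend hK hg' p x]
      refine and_congr_right fun hx => ?_
      rw [dec_mem_below hn K hx]
      constructor
      · rintro ⟨k, -, h, ⟨hhK, y, hy, rfl⟩, e⟩
        refine ⟨?_, e ▸ K.mul_mem (K.pow_mem hgK k) hhK⟩
        clear hhK
        induction k generalizing x with
        | zero =>
          rw [pow_zero, one_mul] at e
          rw [dec_injOn hx (by omega) e]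
          omega
        | succ k ih =>
          have hy' : mul (pow g k) y < 96 := mul_lt (pow_lt hg' k) (by omega)
          have ey : dec (mul (pow g k) y) = dec g ^ k * dec y := by
            rw [dec_mul (pow_lt hg' k) (by omega), dec_pow hg']
          have := (hcover _ (ih _ hy' ey)).1
          rwa [← dec_injOn hx (mul_lt hg' hy')
            (by rw [e, dec_mul hg' hy', ey, pow_succ', mul_assoc])] at this
      · rintro ⟨hxn, hxK⟩
        obtain ⟨k, hk, hy⟩ := (hcover x hxn).2
        have ey : dec (mul (inv (pow g k)) x) = (dec g ^ k)⁻¹ * dec x := by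
          rw [dec_mul (inv_lt (pow_lt hg' k)) hx, dec_inv (pow_lt hg' k), dec_pow hg']
        refine ⟨k, hk, dec (mul (inv (pow g k)) x), ⟨?_, _, hy, rfl⟩, ?_⟩
        · rw [ey]
          exact K.mul_mem (K.inv_mem (K.pow_mem hgK k)) hxK
        · rw [ey, mul_inv_cancel_left]
  · refine ⟨l, mem_step.2 (Or.inl hl), fun x => ?_⟩
    rw [hlK]
    constructor
    · exact fun ⟨h, h'⟩ => ⟨by omega, (dec_mem_below hn K (by omega)).2 ⟨by omega, h'⟩⟩
    · rintro ⟨h, h'⟩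
      obtain ⟨h₁, h₂⟩ := (dec_mem_below hn K h).1 h'
      exact ⟨not_le.1 fun hnx => hx ⟨x, hnx, h₁, h₂⟩, h₂⟩

lemma exists_codes_of_mem_subgroups :
    ∀ l ∈ subgroups, ∃ K : Subgroup (Whitten 3), Codes l K := by
  have h₁ : ∀ l ∈ [[0]], ∃ K : Subgroup (Whitten 3), Codes l K := by
    intro l hl
    refine ⟨⊥, fun x => ?_⟩
    rw [List.mem_singleton.1 hl, List.mem_singleton, SetLike.mem_coe, Subgroup.mem_bot, ← dec_zero]
    exact ⟨fun h => by simp [h], fun ⟨h, e⟩ => dec_injOn h (by norm_num) e⟩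
  have h₂ := exists_codes_of_mem_step (n := 1) (p := 2) (by norm_num) (by norm_num) h₁
  have h₄ := exists_codes_of_mem_step (n := 2) (p := 2) (by norm_num) (by norm_num) h₂
  have h₈ := exists_codes_of_mem_step (n := 4) (p := 2) (by norm_num) (by norm_num) h₄
  have h₁₆ := exists_codes_of_mem_step (n := 8) (p := 2) (by norm_num) (by norm_num) h₈
  have h₄₈ := exists_codes_of_mem_step (n := 16) (p := 3) (by norm_num) (by norm_num) h₁₆
  exact exists_codes_of_mem_step (n := 48) (p := 2) (by norm_num) (by norm_num) h₄₈

lemma exists_mem_subgroups (K : Subgroup (Whitten 3)) : ∃ l ∈ subgroups, Codes l K := by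
  have h₁ : ∃ l ∈ [[0]], Codes l (below 1 K) := by
    refine ⟨[0], by simp, fun x => ⟨fun h => ?_, fun ⟨h, h'⟩ => ?_⟩⟩
    · rw [List.mem_singleton.1 h, dec_mem_below (by norm_num) K (by norm_num), dec_zero]
      exact ⟨by norm_num, by norm_num, K.one_mem⟩
    · have := ((dec_mem_below (by norm_num) K h).1 h').1
      simp only [List.mem_singleton]
      omega
  have h₂ := exists_mem_step (p := 2) (by norm_num) (by norm_num) (by decide +kernel) K h₁
  have h₄ := exists_mem_step (p := 2) (by norm_num) (by norm_num) (by decide +kernel) K h₂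
  have h₈ := exists_mem_step (p := 2) (by norm_num) (by norm_num) (by decide +kernel) K h₄
  have h₁₆ := exists_mem_step (p := 2) (by norm_num) (by norm_num) (by decide +kernel) K h₈
  have h₄₈ := exists_mem_step (p := 3) (by norm_num) (by norm_num) (by decide +kernel) K h₁₆
  obtain ⟨l, hl, h⟩ :=
    exists_mem_step (p := 2) (by norm_num) (by norm_num) (by decide +kernel) K h₄₈
  refine ⟨l, hl, fun x => (h x).trans (and_congr_right fun hx => ?_)⟩
  rw [dec_mem_below (by norm_num) K hx]
  exact and_iff_right hx

/-! ### Subgroups and conjugacy classes as numbers -/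

open scoped Classical in
/-- The mask of the numbers of the elements of `K`. -/
noncomputable def code (K : Subgroup (Whitten 3)) : ℕ :=
  mask ((List.range 96).filter fun x => dec x ∈ K)

lemma Codes.mask_eq {l : List ℕ} {K : Subgroup (Whitten 3)} (h : Codes l K) : mask l = code K := by
  refine mask_eq_iff.2 fun x => ?_
  rw [h x]
  simp

lemma code_injective : Function.Injective code := by
  intro K K' h
  ext a
  obtain ⟨x, hx, rfl⟩ := exists_dec_eq a
  have := mask_eq_iff.1 h x
  simpa [hx] using this

lemma range_code : Set.range code = {m | m ∈ map mask subgroups} := by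
  ext m
  rw [Set.mem_ofPred_eq, map_eq_map, List.mem_map]
  constructor
  · rintro ⟨K, rfl⟩
    obtain ⟨l, hl, h⟩ := exists_mem_subgroups K
    exact ⟨l, hl, h.mask_eq⟩
  · rintro ⟨l, hl, rfl⟩
    obtain ⟨K, h⟩ := exists_codes_of_mem_subgroups l hl
    exact ⟨K, h.mask_eq.symm⟩

/-- The number whose digits in base `256` are the conjugates by `g` of all elements. -/
noncomputable def conjTable (g : ℕ) : ℕ :=
  digits ((List.range 96).map fun x => mul (mul g x) (inv g))

/-- The conjugation tables of representatives of the cosets of the centre. -/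
noncomputable def conjTables : List ℕ := (List.range 24).map fun j => conjTable (4 * j)

/-- The mask of the image of `l` under the function with table `t`. -/
noncomputable def imageMask (l : List ℕ) (t : ℕ) : ℕ :=
  fold (fun x m => Nat.lor (Nat.pow 2 (lookup t x)) m) 0 l

/-- The least mask of an image of `l` under the functions with tables in `T`. -/
noncomputable def leastImage (T : List ℕ) (l : List ℕ) : ℕ :=
  fold (fun t m => force (imageMask l t) fun a => bif Nat.ble a m then a else m) (mask l) T

lemma lookup_conjTable {g x : ℕ} (hg : g < 96) (hx : x < 96) :
    lookup (conjTable g) x = mul (mul g x) (inv g) := by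
  rw [conjTable, lookup_digits _ _ _ (by simpa using hx)]
  · simp
  · simp only [List.mem_map, List.mem_range]
    rintro _ ⟨y, hy, rfl⟩
    have := mul_lt (mul_lt hg hy) (inv_lt hg)
    omega

lemma imageMask_eq (l : List ℕ) (t : ℕ) : imageMask l t = mask (l.map (lookup t)) := by
  rw [imageMask, mask, fold_eq_foldr, fold_eq_foldr, List.foldr_map]

lemma isLeast_leastImage (T l : List ℕ) :
    IsLeast {m | m = mask l ∨ ∃ t ∈ T, m = imageMask l t} (leastImage T l) := by
  have leastImage_cons (t : ℕ) (T : List ℕ) :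
      leastImage (t :: T) l = min (imageMask l t) (leastImage T l) := by
    have e : leastImage (t :: T) l = force (imageMask l t) fun a =>
      bif Nat.ble a (leastImage T l) then a else leastImage T l := rfl
    rw [e, force_eq]
    rcases le_or_gt (imageMask l t) (leastImage T l) with h | h
    · rw [Nat.ble_eq_true_of_le h, min_eq_left h, cond_true]
    · rw [min_eq_right h.le, Bool.eq_false_iff.2 fun h' => h.not_ge (Nat.le_of_ble_eq_true h'),
        cond_false]
  induction T with
  | nil => exact ⟨Or.inl rfl, by rintro m (rfl | ⟨t, ht, -⟩); exacts [le_rfl, by simp at ht]⟩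
  | cons t T ih =>
    rw [leastImage_cons]
    constructor
    · rcases min_choice (imageMask l t) (leastImage T l) with h | h <;> rw [h]
      · exact Or.inr ⟨t, by simp, rfl⟩
      · exact ih.1.imp_right fun ⟨s, hs, e⟩ => ⟨s, by simp [hs], e⟩
    · rintro m (rfl | ⟨s, hs, rfl⟩)
      · exact min_le_of_right_le (ih.2 (Or.inl rfl))
      · rcases List.mem_cons.1 hs with rfl | hs
        · exact min_le_left _ _
        · exact min_le_of_right_le (ih.2 (Or.inr ⟨s, hs, rfl⟩))

/-- The conjugate of a subgroup. -/
def conj (g : Whitten 3) (K : Subgroup (Whitten 3)) : Subgroup (Whitten 3) :=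
  K.map (MulAut.conj g).toMonoidHom

lemma Codes.imageMask_conjTable {l : List ℕ} {K : Subgroup (Whitten 3)} (h : Codes l K) {g : ℕ}
    (hg : g < 96) : imageMask l (conjTable g) = code (conj (dec g) K) := by
  rw [imageMask_eq]
  refine Codes.mask_eq fun x => ?_
  rw [List.mem_map]
  have e {y : ℕ} (hy : y < 96) :
      dec (mul (mul g y) (inv g)) = dec g * dec y * (dec g)⁻¹ := by
    rw [dec_mul (mul_lt hg hy) (inv_lt hg), dec_mul hg hy, dec_inv hg]
  constructor
  · rintro ⟨y, hy, rfl⟩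
    obtain ⟨hy, hyK⟩ := (h y).1 hy
    rw [lookup_conjTable hg hy, e hy]
    exact ⟨mul_lt (mul_lt hg hy) (inv_lt hg), _, hyK, rfl⟩
  · rintro ⟨hx, a, ha, hax⟩
    obtain ⟨y, hy, rfl⟩ := exists_dec_eq a
    refine ⟨y, (h y).2 ⟨hy, ha⟩, ?_⟩
    rw [lookup_conjTable hg hy]
    exact dec_injOn (mul_lt (mul_lt hg hy) (inv_lt hg)) hx ((e hy).trans hax)

lemma mul_comm_of_mem_centre : ∀ z ∈ [0, 1, 14, 15], z < 96 ∧ ∀ x < 96, mul z x = mul x z := by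
  decide +kernel

lemma exists_mul_centre : ∀ i < 96, ∃ j < 24, ∃ z ∈ [0, 1, 14, 15], mul (4 * j) z = i := by
  decide +kernel

lemma conj_mul (g h : Whitten 3) (K : Subgroup (Whitten 3)) :
    conj (g * h) K = conj g (conj h K) := by
  rw [conj, conj, conj, Subgroup.map_map, map_mul]
  rfl

lemma conj_one (K : Subgroup (Whitten 3)) : conj 1 K = K := by
  rw [conj, map_one]
  exact Subgroup.map_id K

lemma conj_of_forall_commute {z : Whitten 3} (hz : ∀ a, z * a = a * z)
    (K : Subgroup (Whitten 3)) : conj z K = K := by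
  have : MulAut.conj z = 1 := by
    ext1 a
    rw [MulAut.conj_apply, hz, mul_inv_cancel_right, MulAut.one_apply]
  rw [conj, this]
  exact Subgroup.map_id K

lemma exists_conj_eq (g : Whitten 3) (K : Subgroup (Whitten 3)) :
    ∃ j < 24, conj g K = conj (dec (4 * j)) K := by
  obtain ⟨i, hi, rfl⟩ := exists_dec_eq g
  obtain ⟨j, hj, z, hz, rfl⟩ := exists_mul_centre i hi
  obtain ⟨hz', hz⟩ := mul_comm_of_mem_centre z hz
  refine ⟨j, hj, ?_⟩
  rw [dec_mul (by omega) hz', conj_mul, conj_of_forall_commute (z := dec z)]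
  intro a
  obtain ⟨x, hx, rfl⟩ := exists_dec_eq a
  rw [← dec_mul hz' hx, hz x hx, dec_mul hx hz']

/-- The least code of a conjugate of `K`. -/
noncomputable def classCode (K : Subgroup (Whitten 3)) : ℕ :=
  sInf (Set.range fun g => code (conj g K))

lemma Codes.leastImage_eq {l : List ℕ} {K : Subgroup (Whitten 3)} (h : Codes l K) :
    leastImage conjTables l = classCode K := by
  have key : {m | m = mask l ∨ ∃ t ∈ conjTables, m = imageMask l t} =
      Set.range fun g => code (conj g K) := by
    ext m
    simp only [Set.mem_ofPred_eq, Set.mem_range, conjTables, List.mem_map, List.mem_range]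
    constructor
    · rintro (rfl | ⟨_, ⟨j, hj, rfl⟩, rfl⟩)
      · exact ⟨1, by rw [conj_one, h.mask_eq]⟩
      · exact ⟨dec (4 * j), (h.imageMask_conjTable (by omega)).symm⟩
    · rintro ⟨g, rfl⟩
      obtain ⟨j, hj, e⟩ := exists_conj_eq g K
      exact Or.inr ⟨_, ⟨j, hj, rfl⟩, by rw [e, h.imageMask_conjTable (by omega)]⟩
  have := isLeast_leastImage conjTables l
  rw [key] at this
  exact this.csInf_eq.symm

lemma classCode_eq_iff {K K' : Subgroup (Whitten 3)} :
    classCode K = classCode K' ↔ SubgroupConj K K' := by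
  constructor
  · intro h
    obtain ⟨g, hg⟩ := Nat.sInf_mem (Set.range_nonempty fun g => code (conj g K))
    obtain ⟨g', hg'⟩ := Nat.sInf_mem (Set.range_nonempty fun g => code (conj g K'))
    have e : conj g K = conj g' K' := code_injective (hg.trans (Eq.trans h hg'.symm))
    refine ⟨g'⁻¹ * g, ?_⟩
    change K' = conj (g'⁻¹ * g) K
    rw [conj_mul, e, ← conj_mul, inv_mul_cancel, conj_one]
  · rintro ⟨g, rfl⟩
    change sInf _ = sInf (Set.range fun h => code (conj h (conj g K)))
    congr 1
    simp only [← conj_mul]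
    exact ((Equiv.mulRight g).surjective.range_comp fun h => code (conj h K)).symm

lemma range_classCode : Set.range classCode = {m | m ∈ map (leastImage conjTables) subgroups} := by
  ext m
  rw [Set.mem_ofPred_eq, map_eq_map, List.mem_map]
  constructor
  · rintro ⟨K, rfl⟩
    obtain ⟨l, hl, h⟩ := exists_mem_subgroups K
    exact ⟨l, hl, h.leastImage_eq⟩
  · rintro ⟨l, hl, rfl⟩
    obtain ⟨K, h⟩ := exists_codes_of_mem_subgroups l hl
    exact ⟨K, h.leastImage_eq.symm⟩

lemma card_subgroup : Nat.card (Subgroup (Whitten 3)) = (nub (map mask subgroups)).length := by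
  rw [Nat.card_congr (Equiv.ofInjective code code_injective), range_code, card_setOf_mem]

lemma card_quot_subgroupConj : Nat.card (Quot (@SubgroupConj (Whitten 3) _)) =
    (nub (map (leastImage conjTables) subgroups)).length := by
  let f : Quot (@SubgroupConj (Whitten 3) _) → ℕ :=
    Quot.lift classCode fun _ _ => classCode_eq_iff.2
  have hf : Function.Injective f := by
    rintro ⟨K⟩ ⟨K'⟩ h
    exact Quot.sound (classCode_eq_iff.1 h)
  have hr : Set.range f = Set.range classCode := Set.range_quot_lift _
  rw [Nat.card_congr (Equiv.ofInjective f hf), hr, range_classCode, card_setOf_mem]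

/-- The numbers of subgroups and of conjugacy classes, arranged for evaluation. -/
noncomputable def counts : ℕ × ℕ :=
  forceLists (step 8 2 <| step 4 2 <| step 2 2 <| step 1 2 [[0]]) fun S =>
  forceLists (step 16 3 S) fun S =>
  forceLists (step 48 2 S) fun S =>
  forceList conjTables fun T =>
  forceList (map mask S) fun M =>
  forceList (map (leastImage T) S) fun C => ((nub M).length, (nub C).length)

lemma counts_eq : counts =
    ((nub (map mask subgroups)).length, (nub (map (leastImage conjTables) subgroups)).length) := by
  simp only [counts, forceLists_eq, forceList_eq, subgroups]

set_option maxRecDepth 10000 in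
lemma counts_eq_numerals : counts = (420, 131) := by decide +kernel

end WhittenThree

/-- The Whitten group `Γ₃` has exactly `420` subgroups, falling into exactly `131`
conjugacy classes. -/
theorem whitten_three_card_subgroups_and_conjugacy_classes :
    Nat.card (Subgroup (Whitten 3)) = 420 ∧
    Nat.card (Quot (@SubgroupConj (Whitten 3) _)) = 131 := by
  have h := WhittenThree.counts_eq.symm.trans WhittenThree.counts_eq_numerals
  rw [Prod.mk.injEq] at h
  exact ⟨WhittenThree.card_subgroup.trans h.1, WhittenThree.card_quot_subgroupConj.trans h.2⟩
end
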